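/- arXiv:2306.03877 — 3 statements merged into one kernel-verified Lean document; each statement's English description precedes it below -/
import Mathlib

section
/- Consider the Mover–Eater game with fixed distinct goals g₁, g₂ ∈ ℤ², initial position p(0) and initial consumption b(0). For each i ∈ {1,2} and every admissible Mover strategy π^M_i for game G_i, the outcomes against the equilibrium Eater strategy satisfy J_i(π^{M*}_i, π^{E*}) ≤ J_i(π^M_i, π^{E*}); that is, π^{M*}_i is a best response to π^{E*} in game G_i. -/
noncomputable section

open Classical

/-- Manhattan distance on the grid ℤ². -/
def mdist (p q : ℤ × ℤ) : ℤ := |p.1 - q.1| + |p.2 - q.2|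

/-- The four admissible unit moves of the Mover. -/
def IsUnitMove (e : ℤ × ℤ) : Prop :=
  e = (1, 0) ∨ e = (-1, 0) ∨ e = (0, 1) ∨ e = (0, -1)

/-- The Eater action that eats one banana from goal `j`. -/
def eatOne (j : Fin 2) : Fin 2 → ℝ := fun k => if k = j then 1 else 0

/-- The Eater action that eats half a banana from each goal. -/
def eatHalf : Fin 2 → ℝ := fun _ => 1 / 2

/-- The three admissible Eater actions. -/
def IsEaterAction (a : Fin 2 → ℝ) : Prop :=
  a = eatOne 0 ∨ a = eatOne 1 ∨ a = eatHalf

/-- A Mover strategy: maps (position, consumption vector) to a move. -/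
abbrev MoverStrategy : Type := ℤ × ℤ → (Fin 2 → ℝ) → ℤ × ℤ

/-- An Eater strategy: maps (new Mover position, last Mover move, current consumption)
to an Eater action; it is the same in both games. -/
abbrev EaterStrategy : Type := ℤ × ℤ → ℤ × ℤ → (Fin 2 → ℝ) → Fin 2 → ℝ

def ValidMover (piM : MoverStrategy) : Prop := ∀ p b, IsUnitMove (piM p b)

def ValidEater (piE : EaterStrategy) : Prop := ∀ p a b, IsEaterAction (piE p a b)

/-- State trajectory (position, consumption vector) of the game under a strategy pair:
`p(t+1) = p(t) + a^M(t)`, `b(t+1) = b(t) + a^E(t)`. -/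
def traj (piM : MoverStrategy) (piE : EaterStrategy) (p0 : ℤ × ℤ) (b0 : Fin 2 → ℝ) :
    ℕ → (ℤ × ℤ) × (Fin 2 → ℝ)
  | 0 => (p0, b0)
  | t + 1 =>
    let s := traj piM piE p0 b0 t
    let m := piM s.1 s.2
    (s.1 + m, fun j => s.2 j + piE (s.1 + m) m s.2 j)

/-- Termination time of game `G_i`: the first time the Mover's position equals `goal`. -/
def hitTime (piM : MoverStrategy) (piE : EaterStrategy) (p0 : ℤ × ℤ) (b0 : Fin 2 → ℝ)
    (goal : ℤ × ℤ) : ℕ :=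
  sInf {t | (traj piM piE p0 b0 t).1 = goal}

/-- The outcome `J_i` of game `G_i`: consumption at the true goal `g i` at termination. -/
def outcome (g : Fin 2 → ℤ × ℤ) (i : Fin 2) (piM : MoverStrategy) (piE : EaterStrategy)
    (p0 : ℤ × ℤ) (b0 : Fin 2 → ℝ) : ℝ :=
  (traj piM piE p0 b0 (hitTime piM piE p0 b0 (g i))).2 i

/-- Admissibility: the Mover reaches the goal in finite time. -/
def Reaches (piM : MoverStrategy) (piE : EaterStrategy) (p0 : ℤ × ℤ) (b0 : Fin 2 → ℝ)
    (goal : ℤ × ℤ) : Prop :=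
  ∃ t, (traj piM piE p0 b0 t).1 = goal

/-- A step from `p` to `p'` is ambiguous: `δd₁ = δd₂`. -/
def IsAmbStep (g : Fin 2 → ℤ × ℤ) (p p' : ℤ × ℤ) : Prop :=
  mdist p' (g 0) - mdist p (g 0) = mdist p' (g 1) - mdist p (g 1)

/-- A step from `p` to `p'` is explicit: `δd₁ = −δd₂`. -/
def IsExpStep (g : Fin 2 → ℤ × ℤ) (p p' : ℤ × ℤ) : Prop :=
  mdist p' (g 0) - mdist p (g 0) = -(mdist p' (g 1) - mdist p (g 1))

/-- A path of `T` unit moves from `p` to `goal`. -/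
def IsPath (p goal : ℤ × ℤ) (T : ℕ) (q : ℕ → ℤ × ℤ) : Prop :=
  q 0 = p ∧ q T = goal ∧ ∀ t < T, IsUnitMove (q (t + 1) - q t)

/-- Number of ambiguous moves along a path. -/
def ambCount (g : Fin 2 → ℤ × ℤ) (T : ℕ) (q : ℕ → ℤ × ℤ) : ℕ :=
  ((Finset.range T).filter fun t => IsAmbStep g (q t) (q (t + 1))).card

/-- Number of explicit moves along a path. -/
def expCount (g : Fin 2 → ℤ × ℤ) (T : ℕ) (q : ℕ → ℤ × ℤ) : ℕ :=
  ((Finset.range T).filter fun t => IsExpStep g (q t) (q (t + 1))).card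

/-- `n^a(p)`: minimum number of ambiguous moves over paths from `p` to a goal. -/
def naN (g : Fin 2 → ℤ × ℤ) (p : ℤ × ℤ) : ℕ :=
  sInf {n : ℕ | ∃ i : Fin 2, ∃ T q, IsPath p (g i) T q ∧ ambCount g T q = n}

/-- `n^r_i(p)`: minimum number of explicit moves needed to reach `g i` from `p`. -/
def nrN (g : Fin 2 → ℤ × ℤ) (i : Fin 2) (p : ℤ × ℤ) : ℕ :=
  sInf {n : ℕ | ∃ T q, IsPath p (g i) T q ∧ expCount g T q = n}

/-- The equilibrium Eater strategy `π^{E*}`: after an ambiguous Mover move the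
conservative action (based on the sign of `δ̃c₁`), after an explicit move the
exploiting action (eat from the approached goal). -/
def piEstar (g : Fin 2 → ℤ × ℤ) : EaterStrategy := fun p' a b =>
  let p := p' - a
  let d1 := mdist p' (g 0) - mdist p (g 0)
  let d2 := mdist p' (g 1) - mdist p (g 1)
  if d1 = d2 then
    if (b 0 + (mdist p' (g 0) : ℝ)) - (b 1 + (mdist p' (g 1) : ℝ)) < 0 then eatOne 0
    else if 0 < (b 0 + (mdist p' (g 0) : ℝ)) - (b 1 + (mdist p' (g 1) : ℝ)) then eatOne 1
    else eatHalf
  else if d1 < d2 then eatOne 0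
  else eatOne 1

/-- `π^{M*}_i`: the Mover strategy that (against any Eater strategy) follows a shortest
path from `p0` to `g i`, performing all `n^a(p0)` ambiguous moves first and then the
explicit moves. -/
def IsMoverStar (g : Fin 2 → ℤ × ℤ) (i : Fin 2) (p0 : ℤ × ℤ) (b0 : Fin 2 → ℝ)
    (piM : MoverStrategy) : Prop :=
  ValidMover piM ∧
  ∀ piE : EaterStrategy, ValidEater piE →
    (traj piM piE p0 b0 (mdist p0 (g i)).toNat).1 = g i ∧
    ∀ t < (mdist p0 (g i)).toNat,
      (IsAmbStep g (traj piM piE p0 b0 t).1 (traj piM piE p0 b0 (t + 1)).1 ↔ t < naN g p0)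

/-- `c_i(p, b) = b_i + d(p, g_i)`. -/
def cval (g : Fin 2 → ℤ × ℤ) (i : Fin 2) (p : ℤ × ℤ) (b : Fin 2 → ℝ) : ℝ :=
  b i + (mdist p (g i) : ℝ)

/-- `δc_i = c_i − c_{3−i}`. -/
def dcval (g : Fin 2 → ℤ × ℤ) (i : Fin 2) (p : ℤ × ℤ) (b : Fin 2 → ℝ) : ℝ :=
  cval g i p b - cval g (1 - i) p b

end

noncomputable def VV : ℕ → ℝ → ℝ → ℝ
  | 0, x, _ => x
  | n + 1, x, y =>
    if x < y then VV n x (y - 1) else if y < x then VV n (x - 1) y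
    else VV n (x - 1 / 2) (y - 1 / 2)

theorem VV_lt (n : ℕ) (x y : ℝ) (h : x < y) : VV (n + 1) x y = VV n x (y - 1) := by
  rw [VV, if_pos h]

theorem VV_gt (n : ℕ) (x y : ℝ) (h : y < x) : VV (n + 1) x y = VV n (x - 1) y := by
  rw [VV, if_neg (by linarith), if_pos h]

theorem VV_eq (n : ℕ) (x y : ℝ) (h : x = y) :
    VV (n + 1) x y = VV n (x - 1 / 2) (y - 1 / 2) := by
  rw [VV, if_neg (by linarith), if_neg (by linarith)]

theorem int_gap (k : ℤ) (h : (0 : ℝ) < k) : (1 : ℝ) ≤ k := by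
  have : (0 : ℤ) < k := by exact_mod_cast h
  exact_mod_cast this

theorem int_gap' (k : ℤ) (h : (k : ℝ) < 0) : (k : ℝ) ≤ -1 := by
  have : k < (0 : ℤ) := by exact_mod_cast h
  have : k ≤ (-1 : ℤ) := by omega
  exact_mod_cast this

theorem VV_mono (n : ℕ) : ∀ (x y x' y' : ℝ), x ≤ x' → y ≤ y' →
    (∃ k : ℤ, (k : ℝ) = (x' - y') - (x - y)) → VV n x y ≤ VV n x' y' := by
  induction n with
  | zero => intro x y x' y' hx _ _; simpa [VV] using hx
  | succ n ih =>
    intro x y x' y' hx hy ⟨k, hk⟩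
    have gp := int_gap k
    have gn := int_gap' k
    rcases lt_trichotomy x y with h | h | h <;> rcases lt_trichotomy x' y' with h' | h' | h' <;>
      simp only [VV_lt, VV_gt, VV_eq, h, h']
    · exact ih _ _ _ _ hx (by linarith) ⟨k, by rw [hk]; ring⟩
    · have := gp (by linarith)
      exact ih _ _ _ _ (by linarith) (by linarith) ⟨k - 1, by push_cast; rw [hk]; linarith⟩
    · have := gp (by linarith)
      exact ih _ _ _ _ (by linarith) (by linarith) ⟨k - 2, by push_cast; rw [hk]; ring⟩
    · have := gn (by linarith)
      exact ih _ _ _ _ (by linarith) (by linarith) ⟨k + 1, by push_cast; rw [hk]; linarith⟩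
    · exact ih _ _ _ _ (by linarith) (by linarith) ⟨0, by push_cast; linarith⟩
    · have := gp (by linarith)
      exact ih _ _ _ _ (by linarith) (by linarith) ⟨k - 1, by push_cast; rw [hk]; linarith⟩
    · have := gn (by linarith)
      exact ih _ _ _ _ (by linarith) (by linarith) ⟨k + 2, by push_cast; rw [hk]; ring⟩
    · have := gn (by linarith)
      exact ih _ _ _ _ (by linarith) (by linarith) ⟨k + 1, by push_cast; rw [hk]; linarith⟩
    · exact ih _ _ _ _ (by linarith) (by linarith) ⟨k, by rw [hk]; ring⟩

/-- An ambiguous retreat does not help. -/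
theorem VV_away (n : ℕ) (x y x' y' : ℝ)
    (h1 : x < y → x' = x + 2 ∧ y' = y + 1)
    (h2 : y < x → x' = x + 1 ∧ y' = y + 2)
    (h3 : x = y → x' = x + 3 / 2 ∧ y' = y + 3 / 2) :
    VV n x y ≤ VV (n + 1) x' y' := by
  rcases lt_trichotomy x y with h | h | h
  · obtain ⟨rfl, rfl⟩ := h1 h
    rcases lt_trichotomy (x + 2) (y + 1) with h' | h' | h'
    · rw [VV_lt _ _ _ h']
      exact VV_mono _ _ _ _ _ (by linarith) (by linarith) ⟨2, by push_cast; ring⟩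
    · rw [VV_eq _ _ _ h']
      exact VV_mono _ _ _ _ _ (by linarith) (by linarith) ⟨1, by push_cast; ring⟩
    · rw [VV_gt _ _ _ h']
      exact VV_mono _ _ _ _ _ (by linarith) (by linarith) ⟨0, by push_cast; ring⟩
  · obtain ⟨rfl, rfl⟩ := h3 h
    rw [VV_eq _ _ _ (by linarith)]
    exact VV_mono _ _ _ _ _ (by linarith) (by linarith) ⟨0, by push_cast; ring⟩
  · obtain ⟨rfl, rfl⟩ := h2 h
    rcases lt_trichotomy (x + 1) (y + 2) with h' | h' | h'
    · rw [VV_lt _ _ _ h']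
      exact VV_mono _ _ _ _ _ (by linarith) (by linarith) ⟨0, by push_cast; ring⟩
    · rw [VV_eq _ _ _ h']
      exact VV_mono _ _ _ _ _ (by linarith) (by linarith) ⟨-1, by push_cast; ring⟩
    · rw [VV_gt _ _ _ h']
      exact VV_mono _ _ _ _ _ (by linarith) (by linarith) ⟨-2, by push_cast; ring⟩

theorem mdist_step (p q m : ℤ × ℤ) (h : IsUnitMove m) :
    mdist (p + m) q = mdist p q + 1 ∨ mdist (p + m) q = mdist p q - 1 := by
  rcases h with rfl | rfl | rfl | rfl <;> simp only [mdist, abs_eq_max_neg, Prod.fst_add, Prod.snd_add] <;> omega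

theorem mdist_nonneg (p q : ℤ × ℤ) : 0 ≤ mdist p q := by
  simp only [mdist, abs_eq_max_neg]; omega

theorem mdist_tri (p q r : ℤ × ℤ) : mdist q r ≤ mdist p q + mdist p r := by
  simp only [mdist, abs_eq_max_neg]; omega

theorem mdist_self (p : ℤ × ℤ) : mdist p p = 0 := by
  simp only [mdist, abs_eq_max_neg]; omega

theorem mdist_comm' (p q : ℤ × ℤ) : mdist p q = mdist q p := by
  simp only [mdist, abs_eq_max_neg]; omega

theorem eq_of_mdist {p q : ℤ × ℤ} (h : mdist p q = 0) : p = q := by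
  simp only [mdist, abs_eq_max_neg] at h; ext <;> omega

theorem validE (g : Fin 2 → ℤ × ℤ) : ValidEater (piEstar g) := by
  intro p a b
  simp only [piEstar, IsEaterAction]
  split_ifs <;> simp

/-- number of remaining ambiguous moves -/
noncomputable def rem (g : Fin 2 → ℤ × ℤ) (i : Fin 2) (p : ℤ × ℤ) : ℕ :=
  ((mdist p (g i) + mdist p (g (1 - i)) - mdist (g i) (g (1 - i))) / 2).toNat

noncomputable def WW (g : Fin 2 → ℤ × ℤ) (i : Fin 2) (p : ℤ × ℤ) (b : Fin 2 → ℝ) : ℝ :=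
  VV (rem g i p) (cval g i p b) (cval g (1 - i) p b)

theorem act_exp (g : Fin 2 → ℤ × ℤ) (i : Fin 2) (p m : ℤ × ℤ) (b : Fin 2 → ℝ)
    (h : mdist (p + m) (g i) - mdist p (g i) < mdist (p + m) (g (1 - i)) - mdist p (g (1 - i))) :
    piEstar g (p + m) m b i = 1 ∧ piEstar g (p + m) m b (1 - i) = 0 := by
  fin_cases i
  · simp at h
    have h2 := h.ne
    simp [piEstar, eatOne, h, h2]
  · simp at h
    have h2 := h.ne'
    have h3 := h.le
    simp [piEstar, eatOne, h2, not_lt.2 h3]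

theorem act_amb (g : Fin 2 → ℤ × ℤ) (i : Fin 2) (p m : ℤ × ℤ) (b : Fin 2 → ℝ)
    (h : mdist (p + m) (g i) - mdist p (g i) = mdist (p + m) (g (1 - i)) - mdist p (g (1 - i))) :
    (cval g i p b < cval g (1 - i) p b →
      piEstar g (p + m) m b i = 1 ∧ piEstar g (p + m) m b (1 - i) = 0) ∧
    (cval g (1 - i) p b < cval g i p b →
      piEstar g (p + m) m b i = 0 ∧ piEstar g (p + m) m b (1 - i) = 1) ∧
    (cval g i p b = cval g (1 - i) p b →
      piEstar g (p + m) m b i = 1 / 2 ∧ piEstar g (p + m) m b (1 - i) = 1 / 2) := by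
  have hr : (mdist (p + m) (g i) : ℝ) - mdist p (g i)
      = mdist (p + m) (g (1 - i)) - mdist p (g (1 - i)) := by exact_mod_cast h
  fin_cases i <;> simp at h hr <;> simp only [cval, piEstar, add_sub_cancel_right] <;>
    simp [h] <;> refine ⟨fun h1 => ?_, fun h1 => ?_, fun h1 => ?_⟩ <;> split_ifs <;>
    first
    | (exfalso; linarith)
    | simp [eatOne, eatHalf]

theorem cval_step (g : Fin 2 → ℤ × ℤ) (j : Fin 2) (p m : ℤ × ℤ) (b : Fin 2 → ℝ) (u : ℝ) (e : ℤ)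
    (a : Fin 2 → ℝ) (ha : a j = u) (he : mdist (p + m) (g j) = mdist p (g j) + e) :
    cval g j (p + m) (fun k => b k + a k) = cval g j p b + u + e := by
  simp only [cval, ha, he]; push_cast; ring

theorem WW_amb_down (g : Fin 2 → ℤ × ℤ) (i : Fin 2) (p m : ℤ × ℤ) (b : Fin 2 → ℝ)
    (h1 : mdist (p + m) (g i) = mdist p (g i) + (-1))
    (h2 : mdist (p + m) (g (1 - i)) = mdist p (g (1 - i)) + (-1)) :
    WW g i (p + m) (fun k => b k + piEstar g (p + m) m b k) = WW g i p b := by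
  have hrem : rem g i p = rem g i (p + m) + 1 := by
    have := mdist_tri (p + m) (g i) (g (1 - i))
    unfold rem; omega
  obtain ⟨a1, a2, a3⟩ := act_amb g i p m b (by omega)
  unfold WW
  rw [hrem]
  rcases lt_trichotomy (cval g i p b) (cval g (1 - i) p b) with h | h | h
  · rw [VV_lt _ _ _ h, cval_step g i p m b _ _ _ (a1 h).1 h1,
      cval_step g (1 - i) p m b _ _ _ (a1 h).2 h2]
    congr 1 <;> push_cast <;> ring
  · rw [VV_eq _ _ _ h, cval_step g i p m b _ _ _ (a3 h).1 h1,
      cval_step g (1 - i) p m b _ _ _ (a3 h).2 h2]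
    congr 1 <;> push_cast <;> ring
  · rw [VV_gt _ _ _ h, cval_step g i p m b _ _ _ (a2 h).1 h1,
      cval_step g (1 - i) p m b _ _ _ (a2 h).2 h2]
    congr 1 <;> push_cast <;> ring

theorem WW_step (g : Fin 2 → ℤ × ℤ) (i : Fin 2) (p m : ℤ × ℤ) (b : Fin 2 → ℝ)
    (hm : IsUnitMove m) :
    WW g i p b ≤ WW g i (p + m) (fun k => b k + piEstar g (p + m) m b k) := by
  rcases mdist_step p (g i) m hm with h1 | h1 <;>
    rcases mdist_step p (g (1 - i)) m hm with h2 | h2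
  · have hrem : rem g i (p + m) = rem g i p + 1 := by
      have := mdist_tri p (g i) (g (1 - i))
      unfold rem; omega
    obtain ⟨a1, a2, a3⟩ := act_amb g i p m b (by omega)
    unfold WW
    rw [hrem]
    refine VV_away _ _ _ _ _ (fun h => ?_) (fun h => ?_) (fun h => ?_)
    · rw [cval_step g i p m b _ _ _ (a1 h).1 h1, cval_step g (1 - i) p m b _ _ _ (a1 h).2 h2]
      constructor <;> push_cast <;> ring
    · rw [cval_step g i p m b _ _ _ (a2 h).1 h1, cval_step g (1 - i) p m b _ _ _ (a2 h).2 h2]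
      constructor <;> push_cast <;> ring
    · rw [cval_step g i p m b _ _ _ (a3 h).1 h1, cval_step g (1 - i) p m b _ _ _ (a3 h).2 h2]
      constructor <;> push_cast <;> ring
  · have hrem : rem g i (p + m) = rem g i p := by unfold rem; congr 2; omega
    have hii : 1 - (1 - i) = i := by simp
    obtain ⟨a1, a2⟩ := act_exp g (1 - i) p m b (by rw [hii]; omega)
    rw [hii] at a2
    unfold WW
    rw [hrem, cval_step g i p m b _ _ _ a2 h1,
      cval_step g (1 - i) p m b _ (-1) _ a1 h2]
    exact VV_mono _ _ _ _ _ (by push_cast; linarith) (by push_cast; linarith)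
      ⟨1, by push_cast; ring⟩
  · have hrem : rem g i (p + m) = rem g i p := by unfold rem; congr 2; omega
    obtain ⟨a1, a2⟩ := act_exp g i p m b (by omega)
    unfold WW
    rw [hrem, cval_step g i p m b _ (-1) _ a1 h1,
      cval_step g (1 - i) p m b _ _ _ a2 h2]
    exact VV_mono _ _ _ _ _ (by push_cast; linarith) (by push_cast; linarith)
      ⟨-1, by push_cast; ring⟩
  · exact (WW_amb_down g i p m b h1 h2).ge

theorem WW_exp_zero (g : Fin 2 → ℤ × ℤ) (i : Fin 2) (p m : ℤ × ℤ) (b : Fin 2 → ℝ)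
    (h1 : mdist (p + m) (g i) = mdist p (g i) + (-1))
    (h2 : mdist (p + m) (g (1 - i)) = mdist p (g (1 - i)) + 1)
    (h0 : rem g i p = 0) :
    WW g i (p + m) (fun k => b k + piEstar g (p + m) m b k) = WW g i p b := by
  have hrem : rem g i (p + m) = rem g i p := by unfold rem; congr 2; omega
  obtain ⟨a1, a2⟩ := act_exp g i p m b (by omega)
  unfold WW
  rw [hrem, h0, cval_step g i p m b _ (-1) _ a1 h1]
  simp [VV]

theorem WW_goal (g : Fin 2 → ℤ × ℤ) (i : Fin 2) (b : Fin 2 → ℝ) : WW g i (g i) b = b i := by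
  simp [WW, rem, mdist_self, VV, cval]

theorem amb_iff (g : Fin 2 → ℤ × ℤ) (i : Fin 2) (p p' : ℤ × ℤ) :
    IsAmbStep g p p' ↔ mdist p' (g i) - mdist p (g i) = mdist p' (g (1 - i)) - mdist p (g (1 - i)) := by
  fin_cases i
  · simp [IsAmbStep]
  · simp [IsAmbStep, eq_comm]

theorem star_val (g : Fin 2 → ℤ × ℤ) (p0 : ℤ × ℤ) (b0 : Fin 2 → ℝ) (i : Fin 2)
    (piM : MoverStrategy) (hstar : IsMoverStar g i p0 b0 piM) :
    outcome g i piM (piEstar g) p0 b0 = WW g i p0 b0 := by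
  obtain ⟨hv, hs⟩ := hstar
  obtain ⟨hN, hA⟩ := hs _ (validE g)
  set N := (mdist p0 (g i)).toNat with hNdef
  set s := traj piM (piEstar g) p0 b0 with hsdef
  have s0 : s 0 = (p0, b0) := rfl
  have ss : ∀ t, s (t + 1) = ((s t).1 + piM (s t).1 (s t).2, fun k => (s t).2 k +
      piEstar g ((s t).1 + piM (s t).1 (s t).2) (piM (s t).1 (s t).2) (s t).2 k) := fun t => rfl
  have hNz : (N : ℤ) = mdist p0 (g i) := Int.toNat_of_nonneg (mdist_nonneg _ _)
  have stp : ∀ t j, mdist (s (t + 1)).1 (g j) = mdist (s t).1 (g j) + 1 ∨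
      mdist (s (t + 1)).1 (g j) = mdist (s t).1 (g j) - 1 := by
    intro t j; rw [ss]; exact mdist_step _ _ _ (hv _ _)
  have lo : ∀ t : ℕ, (N : ℤ) - t ≤ mdist (s t).1 (g i) := by
    intro t
    induction t with
    | zero => simp [s0, hNz]
    | succ t ih => have := stp t i; push_cast; omega
  have up : ∀ k : ℕ, ∀ t : ℕ, t + k = N → mdist (s t).1 (g i) ≤ k := by
    intro k
    induction k with
    | zero => intro t ht; simp at ht; subst ht; rw [hN, mdist_self]; simp
    | succ k ih => intro t ht; have := stp t i; have := ih (t + 1) (by omega); push_cast; omega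
  have dist : ∀ t ≤ N, mdist (s t).1 (g i) = (N : ℤ) - t := by
    intro t ht
    have := lo t
    have := up (N - t) t (by omega)
    omega
  have hit : hitTime piM (piEstar g) p0 b0 (g i) = N := by
    apply le_antisymm
    · exact Nat.sInf_le hN
    · have hne : {t | (traj piM (piEstar g) p0 b0 t).1 = g i}.Nonempty := ⟨N, hN⟩
      apply le_csInf hne
      intro t ht
      have h1 := lo t
      have h2 : (s t).1 = g i := ht
      rw [h2, mdist_self] at h1
      omega
  have rem0 : ∀ k : ℕ, ∀ t : ℕ, t + k = N → naN g p0 ≤ t → rem g i (s t).1 = 0 := by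
    intro k
    induction k with
    | zero => intro t ht _; simp at ht; subst ht; rw [hN]; simp [rem, mdist_self]
    | succ k ih =>
      intro t ht hn
      rw [← ih (t + 1) (by omega) (by omega)]
      have e := (hA t (by omega)).not.2 (by omega)
      rw [amb_iff g i] at e
      have h1 := stp t i
      have h2 := stp t (1 - i)
      unfold rem; congr 2; omega
  have main : ∀ t ≤ N, WW g i (s t).1 (s t).2 = WW g i p0 b0 := by
    intro t
    induction t with
    | zero => intro _; rw [s0]
    | succ t ih =>
      intro ht
      rw [← ih (by omega)]
      have d1 := dist t (by omega)
      have d2 := dist (t + 1) ht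
      have h2 := stp t (1 - i)
      have e := hA t (by omega)
      rw [amb_iff g i] at e
      by_cases hn : t < naN g p0
      · have e' := e.2 hn
        rw [ss] at d2 h2 e' ⊢
        apply WW_amb_down <;> push_cast at * <;> omega
      · have e' := e.not.2 hn
        have r := rem0 (N - t) t (by omega) (by omega)
        rw [ss] at d2 h2 e' ⊢
        apply WW_exp_zero _ _ _ _ _ _ _ r <;> push_cast at * <;> omega
  have := main N le_rfl
  rw [hN, WW_goal] at this
  unfold outcome
  rw [hit]
  exact this

theorem low_val (g : Fin 2 → ℤ × ℤ) (p0 : ℤ × ℤ) (b0 : Fin 2 → ℝ) (i : Fin 2)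
    (piM : MoverStrategy) (hM : ValidMover piM)
    (hadm : Reaches piM (piEstar g) p0 b0 (g i)) :
    WW g i p0 b0 ≤ outcome g i piM (piEstar g) p0 b0 := by
  have main : ∀ t, WW g i p0 b0 ≤
      WW g i (traj piM (piEstar g) p0 b0 t).1 (traj piM (piEstar g) p0 b0 t).2 := by
    intro t
    induction t with
    | zero => exact le_rfl
    | succ t ih => exact ih.trans (WW_step g i _ _ _ (hM _ _))
  have hT : (traj piM (piEstar g) p0 b0 (hitTime piM (piEstar g) p0 b0 (g i))).1 = g i :=
    Nat.sInf_mem (s := {t | (traj piM (piEstar g) p0 b0 t).1 = g i}) hadm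
  have := main (hitTime piM (piEstar g) p0 b0 (g i))
  rw [hT, WW_goal] at this
  exact this

/-- `π^{M*}_i` is a best response to `π^{E*}` in game `G_i`. -/
theorem mover_star_best_response
    (g : Fin 2 → ℤ × ℤ) (hg : g 0 ≠ g 1) (p0 : ℤ × ℤ) (b0 : Fin 2 → ℝ)
    (hb0 : ∀ j, 0 ≤ b0 j) (i : Fin 2)
    (piMstar : MoverStrategy) (hstar : IsMoverStar g i p0 b0 piMstar)
    (piM : MoverStrategy) (hM : ValidMover piM)
    (hadm : Reaches piM (piEstar g) p0 b0 (g i)) :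
    outcome g i piMstar (piEstar g) p0 b0 ≤ outcome g i piM (piEstar g) p0 b0 := by
  rw [star_val g p0 b0 i piMstar hstar]
  exact low_val g p0 b0 i piM hM hadm
end

section
/- Suppose the Mover's move at time t is ambiguous (δd₁(t) = δd₂(t)) and the Eater responds with the conservative action of π^{E*}. Then for each i ∈ {1,2}, δc_i(t+1) − δc_i(t) equals 1 if δc_i(t) < 0, equals −1 if δc_i(t) > 0, and equals 0 if δc_i(t) = 0; i.e., |δc_i| decreases by one toward zero after each ambiguous move answered by the conservative action. -/
/-- after an ambiguous move answered by the conservative action of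
`π^{E*}`, `|δc_i|` decreases by one toward zero. -/
theorem conservative_action_drives_dc_to_zero
    (g : Fin 2 → ℤ × ℤ) (hg : g 0 ≠ g 1) (p e : ℤ × ℤ) (he : IsUnitMove e)
    (b b' : Fin 2 → ℝ) (hamb : IsAmbStep g p (p + e))
    (hb' : ∀ j, b' j = b j + piEstar g (p + e) e b j) (i : Fin 2)
    (dc dc' : ℝ)
    (hdc : dc = (b i + (mdist p (g i) : ℝ)) -
      (b (1 - i) + (mdist p (g (1 - i)) : ℝ)))
    (hdc' : dc' = (b' i + (mdist (p + e) (g i) : ℝ)) -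
      (b' (1 - i) + (mdist (p + e) (g (1 - i)) : ℝ))) :
    (dc < 0 → dc' - dc = 1) ∧ (0 < dc → dc' - dc = -1) ∧ (dc = 0 → dc' - dc = 0) := by
  have h0 := hb' 0
  have h1 := hb' 1
  have ha : ((mdist (p + e) (g 0) : ℤ) : ℝ) - (mdist p (g 0) : ℝ)
      = (mdist (p + e) (g 1) : ℝ) - (mdist p (g 1) : ℝ) := by
    have h := hamb
    unfold IsAmbStep at h
    exact_mod_cast h
  unfold IsAmbStep at hamb
  simp only [piEstar, add_sub_cancel_right, hamb, if_true] at h0 h1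
  have e1 : (1 : Fin 2) - 0 = 1 := rfl
  have e2 : (1 : Fin 2) - 1 = 0 := rfl
  split_ifs at h0 h1 with c1 c2 <;>
  simp [eatOne, eatHalf] at h0 h1 <;>
  fin_cases i <;>
  simp only [Fin.zero_eta, Fin.mk_one, e1, e2] at hdc hdc' <;>
  refine ⟨fun h => ?_, fun h => ?_, fun h => ?_⟩ <;> linarith
end

section
/- Let a path from p to g_i be a finite sequence p = q₀, q₁, …, q_T = q_T in ℤ² with each step a unit move and q_T = g_i, and call it shortest if T = d(p, g_i). Every shortest path from p to g_i contains exactly (d(p,g₁) + d(p,g₂) − d(g₁,g₂))/2 ambiguous moves and exactly (d(p,g_i) + d(g₁,g₂) − d(p,g_{3−i}))/2 explicit moves. In particular, all shortest paths from p to g_i contain the same numbers of ambiguous and explicit moves, and the number of ambiguous moves on a shortest path is the same for both goals g₁ and g₂. -/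
theorem aux_step (a b c : ℤ × ℤ) (h : IsUnitMove (b - a)) :
    mdist b c = mdist a c + 1 ∨ mdist b c = mdist a c - 1 := by
  obtain ⟨a1, a2⟩ := a
  obtain ⟨b1, b2⟩ := b
  obtain ⟨c1, c2⟩ := c
  simp only [IsUnitMove, Prod.mk_sub_mk, Prod.mk.injEq] at h
  simp only [mdist]
  rcases abs_cases (a1 - c1) with h1 | h1 <;> rcases abs_cases (a2 - c2) with h2 | h2 <;>
  rcases abs_cases (b1 - c1) with h3 | h3 <;> rcases abs_cases (b2 - c2) with h4 | h4 <;> omega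

theorem aux_comm (a b : ℤ × ℤ) : mdist a b = mdist b a := by
  simp only [mdist, abs_sub_comm]

theorem aux_self (a : ℤ × ℤ) : mdist a a = 0 := by
  simp [mdist]

theorem aux_step_down (c : ℤ × ℤ) (T : ℕ) (q : ℕ → ℤ × ℤ)
    (hp : IsPath (q 0) c T q) (hs : (T : ℤ) = mdist (q 0) c) :
    ∀ n < T, mdist (q (n + 1)) c = mdist (q n) c - 1 := by
  obtain ⟨-, hT, hu⟩ := hp
  have low : ∀ n ≤ T, mdist (q 0) c ≤ mdist (q n) c + n := by
    intro n
    induction n with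
    | zero => simp
    | succ n ih =>
      intro hn
      have h1 := ih (by omega)
      have h2 := aux_step _ _ c (hu n (by omega))
      push_cast
      omega
  have up : ∀ k n, n + k = T → mdist (q n) c ≤ k := by
    intro k
    induction k with
    | zero =>
      intro n hn
      have : n = T := by omega
      subst this
      rw [hT, aux_self]; simp
    | succ k ih =>
      intro n hn
      have h1 := ih (n + 1) (by omega)
      have h2 := aux_step _ _ c (hu n (by omega))
      push_cast
      omega
  intro n hn
  have h1 := low n hn.le
  have h2 := up (T - (n + 1)) (n + 1) (by omega)
  have h3 := aux_step _ _ c (hu n hn)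
  omega

theorem aux_counts (g : Fin 2 → ℤ × ℤ) (i : Fin 2) (T : ℕ) (q : ℕ → ℤ × ℤ)
    (hd : ∀ n < T, mdist (q (n + 1)) (g i) = mdist (q n) (g i) - 1)
    (hu : ∀ t < T, IsUnitMove (q (t + 1) - q t)) :
    ∀ n ≤ T, 2 * (ambCount g n q : ℤ) = n - (mdist (q n) (g (1 - i)) - mdist (q 0) (g (1 - i))) ∧
      2 * (expCount g n q : ℤ) = n + (mdist (q n) (g (1 - i)) - mdist (q 0) (g (1 - i))) := by
  intro n
  induction n with
  | zero => simp [ambCount, expCount]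
  | succ n ih =>
    intro hn
    obtain ⟨h1, h2⟩ := ih (by omega)
    have h3 := aux_step _ _ (g (1 - i)) (hu n (by omega))
    have h4 := hd n (by omega)
    unfold ambCount expCount at *
    rw [Finset.range_add_one, Finset.filter_insert, Finset.filter_insert]
    have key : (IsAmbStep g (q n) (q (n + 1)) ↔
          mdist (q (n + 1)) (g (1 - i)) = mdist (q n) (g (1 - i)) - 1) ∧
        (IsExpStep g (q n) (q (n + 1)) ↔
          mdist (q (n + 1)) (g (1 - i)) = mdist (q n) (g (1 - i)) + 1) := by
      unfold IsAmbStep IsExpStep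
      fin_cases i
      · simp at h3 h4 ⊢
        omega
      · simp at h3 h4 ⊢
        omega
    rcases h3 with h3 | h3
    · rw [if_neg (fun h => by have := key.1.1 h; omega), if_pos (key.2.2 h3), Finset.card_insert_of_notMem (by simp)]
      push_cast
      omega
    · rw [if_pos (key.1.2 h3), if_neg (fun h => by have := key.2.1 h; omega), Finset.card_insert_of_notMem (by simp)]
      push_cast
      omega

/-- every shortest path from `p` to `g_i` contains exactly
`(d(p,g₁)+d(p,g₂)−d(g₁,g₂))/2` ambiguous moves and
`(d(p,g_i)+d(g₁,g₂)−d(p,g_{3−i}))/2` explicit moves. -/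
theorem shortest_path_move_counts
    (g : Fin 2 → ℤ × ℤ) (hg : g 0 ≠ g 1) (p : ℤ × ℤ) (i : Fin 2)
    (T : ℕ) (q : ℕ → ℤ × ℤ)
    (hpath : IsPath p (g i) T q) (hshort : (T : ℤ) = mdist p (g i)) :
    (ambCount g T q : ℤ) = (mdist p (g 0) + mdist p (g 1) - mdist (g 0) (g 1)) / 2 ∧
    (expCount g T q : ℤ) =
      (mdist p (g i) + mdist (g 0) (g 1) - mdist p (g (1 - i))) / 2 := by
  obtain ⟨h0, hT, hu⟩ := hpath
  subst h0
  have hd := aux_step_down (g i) T q ⟨rfl, hT, hu⟩ hshort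
  obtain ⟨h1, h2⟩ := aux_counts g i T q hd hu T le_rfl
  rw [hT] at h1 h2
  have hc := aux_comm (g 1) (g 0)
  fin_cases i
  · simp at hshort h1 h2 ⊢
    omega
  · simp at hshort h1 h2 ⊢
    omega
end
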